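/- Define S_m = D_{m+1} − D_m. For every m and i with 0 ≤ m ≤ p−1 and 0 ≤ i ≤ p−1 one has S_{pm+i} = B(A_m)_i, where A_0 = p−2 and A_m = p−1−m for 1 ≤ m ≤ p−1, and for q ∈ {0,…,p−2} the block B(q) of length p is given by B(q)_i = p−2−i if i ≤ p−2−q and B(q)_i = p−1−i if i > p−2−q. (In other words, the first p² values of S_j coincide with the first-tier substitution sequence Ŝ_j^(1).) -/

import Mathlib

open MeasureTheory
open scoped NNReal ENNReal

namespace Chacon

/-- The space of digit sequences with digits in `{0, …, p-1}`. -/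
def Gamma (p : ℕ) : Set (ℕ → ℕ) := {x | ∀ i, x i < p}

/-- `Γ*`: sequences with digits `< p` having infinitely many coordinates `≠ p - 1`. -/
def GammaStar (p : ℕ) : Set (ℕ → ℕ) :=
  {x | (∀ i, x i < p) ∧ {i | x i ≠ p - 1}.Infinite}

/-- The least index `i` with `x i ≠ p - 1`. -/
noncomputable def firstNot (p : ℕ) (x : ℕ → ℕ) : ℕ :=
  sInf {i | x i ≠ p - 1}

/-- `φ(x) = x_i` where `i` is the least index with `x_i ≠ p - 1`. -/
noncomputable def phi (p : ℕ) (x : ℕ → ℕ) : ℕ :=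
  x (firstNot p x)

/-- The odometer `S` (addition of `1` with carry): the initial run of digits
`p - 1` is replaced by zeros, and the first digit `≠ p - 1` is increased by one. -/
noncomputable def odo (p : ℕ) (x : ℕ → ℕ) : ℕ → ℕ :=
  fun i =>
    if i < firstNot p x then 0
    else if i = firstNot p x then x i + 1
    else x i

/-- `φ^(m)(x) = ∑_{j=0}^{m-1} φ(S^j x)`. -/
noncomputable def phiSum (p m : ℕ) (x : ℕ → ℕ) : ℕ :=
  ∑ j ∈ Finset.range m, phi p ((odo p)^[j] x)

/-- The base-`p` digit sequence of a real number `u`. -/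
noncomputable def digitsOf (p : ℕ) (u : ℝ) : ℕ → ℕ :=
  fun i => (⌊u * (p : ℝ) ^ (i + 1)⌋).toNat % p

/-- `λ`: the product probability measure on digit sequences under which the
coordinates are i.i.d., uniformly distributed in `{0, …, p-1}`; it is realized
concretely as the distribution of the base-`p` digit sequence of a uniformly
distributed random point of `[0,1)`. -/
noncomputable def lam (p : ℕ) : Measure (ℕ → ℕ) :=
  Measure.map (digitsOf p) (volume.restrict (Set.Ico (0 : ℝ) 1))

/-- `π_m(j) = λ({x : φ^(m)(x) = j})`. -/
noncomputable def pim (p m j : ℕ) : ℝ≥0∞ :=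
  lam p {x | phiSum p m x = j}

/-- `P_m^p(t) = ∑_{j ≥ 0} π_m(j) t^j`, a real polynomial
(the sum is over `0 ≤ j ≤ m (p-2)` since `0 ≤ φ^(m) ≤ m (p-2)` a.s.). -/
noncomputable def P (p m : ℕ) (t : ℝ) : ℝ :=
  ∑ j ∈ Finset.range (m * (p - 2) + 1), (pim p m j).toReal * t ^ j

/-- The `n`-th triangular number `Δ_n = n (n+1) / 2`. -/
def tri (n : ℕ) : ℕ := n * (n + 1) / 2

/-- The degree `D_m` of `P_m^p`: the largest `j` with `π_m(j) ≠ 0`. -/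
noncomputable def D (p m : ℕ) : ℕ := sSup {j | pim p m j ≠ 0}

/-- The lower degree `d_m` of `P_m^p`: the least `j` with `π_m(j) ≠ 0`. -/
noncomputable def d (p m : ℕ) : ℕ := sInf {j | pim p m j ≠ 0}


/-- `S_m = D_{m+1} - D_m`. -/
noncomputable def Sseq (p m : ℕ) : ℕ := D p (m + 1) - D p m

/-- The substitution block `B(q)` of length `p`: the descending sequence
`p-2, p-3, …, 1, 0` with the value `q` repeated twice in a row. -/
def blockB (p q i : ℕ) : ℕ := if i ≤ p - 2 - q then p - 2 - i else p - 1 - i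

/-- The digit sequence with first digit `s` followed by the digits of `y`. -/
def consDigit (s : ℕ) (y : ℕ → ℕ) : ℕ → ℕ
  | 0 => s
  | n + 1 => y n

lemma consDigit_eta (x : ℕ → ℕ) : consDigit (x 0) (fun i => x (i + 1)) = x := by
  funext i; cases i <;> rfl

lemma firstNot_eq {p : ℕ} {x : ℕ → ℕ} {n : ℕ} (hn : x n ≠ p - 1)
    (hlt : ∀ i < n, x i = p - 1) : firstNot p x = n := by
  apply le_antisymm (Nat.sInf_le hn)
  by_contra! h
  exact Nat.sInf_mem (s := {i | x i ≠ p - 1}) ⟨n, hn⟩ (hlt _ h)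

lemma firstNot_spec {p : ℕ} {x : ℕ → ℕ} (hx : x ∈ GammaStar p) :
    x (firstNot p x) ≠ p - 1 :=
  Nat.sInf_mem hx.2.nonempty

lemma eq_of_lt_firstNot {p : ℕ} {x : ℕ → ℕ} {i : ℕ} (hi : i < firstNot p x) :
    x i = p - 1 := by
  by_contra h
  exact Nat.notMem_of_lt_sInf hi h

lemma consDigit_mem_iff {p s : ℕ} {y : ℕ → ℕ} :
    consDigit s y ∈ GammaStar p ↔ s < p ∧ y ∈ GammaStar p := by
  simp only [GammaStar, Set.mem_ofPred_eq, ← Nat.frequently_atTop_iff_infinite]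
  have h : (∃ᶠ n in Filter.atTop, consDigit s y n ≠ p - 1) ↔
      ∃ᶠ n in Filter.atTop, y n ≠ p - 1 := by
    conv_lhs => rw [← Filter.map_add_atTop_eq_nat 1, Filter.frequently_map]
    rfl
  rw [h]
  constructor
  · rintro ⟨h1, h2⟩
    exact ⟨h1 0, fun i => h1 (i + 1), h2⟩
  · rintro ⟨h0, h1, h2⟩
    exact ⟨fun i => by cases i with | zero => exact h0 | succ i => exact h1 i, h2⟩

lemma odo_mem {p : ℕ} {x : ℕ → ℕ} (hx : x ∈ GammaStar p) : odo p x ∈ GammaStar p := by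
  have h1 := firstNot_spec hx
  refine ⟨fun i => ?_, ?_⟩
  · have h2 := hx.1 i
    unfold odo
    split_ifs with h3 h4
    · omega
    · subst h4; omega
    · exact h2
  · refine (hx.2.sdiff (Set.finite_Iic (firstNot p x))).mono ?_
    rintro i ⟨hi, hi'⟩
    have h2 : firstNot p x < i := by simpa using hi'
    simpa [odo, h2.not_gt, h2.ne'] using hi

lemma odo_iterate_mem {p : ℕ} {x : ℕ → ℕ} (hx : x ∈ GammaStar p) (k : ℕ) :
    (odo p)^[k] x ∈ GammaStar p := by
  induction k with
  | zero => exact hx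
  | succ k ih => rw [Function.iterate_succ_apply']; exact odo_mem ih

lemma phi_le {p : ℕ} {x : ℕ → ℕ} (hx : x ∈ GammaStar p) : phi p x ≤ p - 2 := by
  have h1 := firstNot_spec hx
  have h2 := hx.1 (firstNot p x)
  unfold phi
  omega

lemma phiSum_zero (p : ℕ) (x : ℕ → ℕ) : phiSum p 0 x = 0 := rfl

lemma phiSum_one (p : ℕ) (x : ℕ → ℕ) : phiSum p 1 x = phi p x := by
  simp [phiSum]

lemma phiSum_add (p a b : ℕ) (x : ℕ → ℕ) :
    phiSum p (a + b) x = phiSum p a x + phiSum p b ((odo p)^[a] x) := by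
  unfold phiSum
  rw [Finset.sum_range_add]
  congr 1
  refine Finset.sum_congr rfl fun j _ => ?_
  rw [← Function.iterate_add_apply, add_comm a j]

lemma phiSum_le {p m : ℕ} {x : ℕ → ℕ} (hx : x ∈ GammaStar p) :
    phiSum p m x ≤ m * (p - 2) := by
  simpa [phiSum] using Finset.sum_le_card_nsmul (Finset.range m) _ (p - 2)
    (fun j _ => phi_le (odo_iterate_mem hx j))

/-- On `Γ*` the value `φ^(m)(x)` is determined by finitely many digits of `x`. -/
lemma exists_phiSum_eq_of_digits_eq {p : ℕ} (m : ℕ) {x : ℕ → ℕ} (hx : x ∈ GammaStar p) :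
    ∃ N, ∀ y : ℕ → ℕ, (∀ i < N, y i = x i) → phiSum p m y = phiSum p m x := by
  induction m generalizing x with
  | zero => exact ⟨0, fun _ _ => rfl⟩
  | succ m ih =>
    obtain ⟨N, hN⟩ := ih (odo_mem hx)
    refine ⟨max N (firstNot p x + 1), fun y hy => ?_⟩
    have hf : firstNot p y = firstNot p x := by
      apply firstNot_eq
      · rw [hy _ (by simp)]; exact firstNot_spec hx
      · intro i hi
        rw [hy i (lt_max_of_lt_right (by omega))]
        exact eq_of_lt_firstNot hi
    rw [add_comm m 1, phiSum_add, phiSum_add, phiSum_one, phiSum_one, Function.iterate_one]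
    congr 1
    · unfold phi
      rw [hf, hy _ (by simp)]
    · refine hN _ fun i hi => ?_
      unfold odo
      rw [hf, hy i (lt_max_of_lt_left hi)]

lemma firstNot_consDigit_of_ne {p s : ℕ} (hs : s ≠ p - 1) (y : ℕ → ℕ) :
    firstNot p (consDigit s y) = 0 :=
  firstNot_eq hs (by simp)

lemma firstNot_consDigit_last {p : ℕ} {y : ℕ → ℕ} (hy : y ∈ GammaStar p) :
    firstNot p (consDigit (p - 1) y) = firstNot p y + 1 := by
  refine firstNot_eq (firstNot_spec hy) fun i hi => ?_
  cases i with
  | zero => rfl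
  | succ i => exact eq_of_lt_firstNot (x := y) (by omega)

lemma phi_consDigit_of_ne {p s : ℕ} (hs : s ≠ p - 1) (y : ℕ → ℕ) :
    phi p (consDigit s y) = s := by
  rw [phi, firstNot_consDigit_of_ne hs]; rfl

lemma phi_consDigit_last {p : ℕ} {y : ℕ → ℕ} (hy : y ∈ GammaStar p) :
    phi p (consDigit (p - 1) y) = phi p y := by
  rw [phi, firstNot_consDigit_last hy]; rfl

lemma odo_consDigit_of_ne {p s : ℕ} (hs : s ≠ p - 1) (y : ℕ → ℕ) :
    odo p (consDigit s y) = consDigit (s + 1) y := by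
  funext i
  rw [odo, firstNot_consDigit_of_ne hs]
  cases i <;> simp [consDigit]

lemma odo_consDigit_last {p : ℕ} {y : ℕ → ℕ} (hy : y ∈ GammaStar p) :
    odo p (consDigit (p - 1) y) = consDigit 0 (odo p y) := by
  funext i
  rw [odo, firstNot_consDigit_last hy]
  cases i <;> simp [consDigit, odo]

lemma odo_iterate_consDigit_of_le {p s k : ℕ} (h : s + k ≤ p - 1) (y : ℕ → ℕ) :
    (odo p)^[k] (consDigit s y) = consDigit (s + k) y := by
  induction k with
  | zero => rfl
  | succ k ih =>
    rw [Function.iterate_succ_apply', ih (by omega), odo_consDigit_of_ne (by omega), add_assoc]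

lemma phiSum_consDigit_of_le {p s k : ℕ} (h : s + k ≤ p - 1) (y : ℕ → ℕ) :
    phiSum p k (consDigit s y) = ∑ j ∈ Finset.range k, (s + j) := by
  refine Finset.sum_congr rfl fun j hj => ?_
  have hj' := Finset.mem_range.mp hj
  rw [odo_iterate_consDigit_of_le (by omega), phi_consDigit_of_ne (by omega)]

lemma odo_iterate_consDigit_carry {p s : ℕ} (hs : s < p) {y : ℕ → ℕ} (hy : y ∈ GammaStar p) :
    (odo p)^[p - s] (consDigit s y) = consDigit 0 (odo p y) := by
  rw [show p - s = (p - 1 - s) + 1 by omega, Function.iterate_succ_apply',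
    odo_iterate_consDigit_of_le (by omega), show s + (p - 1 - s) = p - 1 by omega,
    odo_consDigit_last hy]

lemma phiSum_consDigit_carry {p s : ℕ} (hs : s < p) {y : ℕ → ℕ} (hy : y ∈ GammaStar p) :
    phiSum p (p - s) (consDigit s y) =
      ∑ j ∈ Finset.range (p - 1 - s), (s + j) + phi p y := by
  rw [show p - s = (p - 1 - s) + 1 by omega, phiSum_add, phiSum_consDigit_of_le (by omega),
    odo_iterate_consDigit_of_le (by omega), show s + (p - 1 - s) = p - 1 by omega, phiSum_one,
    phi_consDigit_last hy]

lemma phiSum_consDigit_of_ge {p s i : ℕ} (hs : s < p) (hi : i < p) (h : p ≤ s + i)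
    {y : ℕ → ℕ} (hy : y ∈ GammaStar p) :
    phiSum p i (consDigit s y) = ∑ j ∈ Finset.range (p - 1 - s), (s + j) + phi p y +
      ∑ j ∈ Finset.range (s + i - p), j := by
  conv_lhs => rw [show i = (p - s) + (s + i - p) by omega]
  rw [phiSum_add, phiSum_consDigit_carry hs hy, odo_iterate_consDigit_carry hs hy,
    phiSum_consDigit_of_le (by omega)]
  simp

lemma odo_iterate_period {p s : ℕ} (hs : s < p) {y : ℕ → ℕ} (hy : y ∈ GammaStar p) :
    (odo p)^[p] (consDigit s y) = consDigit s (odo p y) := by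
  conv_lhs => rw [show p = s + (p - s) by omega]
  rw [Function.iterate_add_apply, show s + (p - s) = p by omega,
    odo_iterate_consDigit_carry hs hy, odo_iterate_consDigit_of_le (by omega), zero_add]

lemma phiSum_period {p s : ℕ} (hs : s < p) {y : ℕ → ℕ} (hy : y ∈ GammaStar p) :
    phiSum p p (consDigit s y) = ∑ j ∈ Finset.range (p - 1), j + phi p y := by
  have h : phiSum p ((p - s) + s) (consDigit s y) =
      ∑ j ∈ Finset.range (s + (p - 1 - s)), j + phi p y := by
    rw [phiSum_add, phiSum_consDigit_carry hs hy, odo_iterate_consDigit_carry hs hy,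
      phiSum_consDigit_of_le (by omega), Finset.sum_range_add]
    simp only [zero_add]
    ring
  rwa [show (p - s) + s = p by omega, show s + (p - 1 - s) = p - 1 by omega] at h

lemma odo_iterate_mul {p s : ℕ} (hs : s < p) {y : ℕ → ℕ} (hy : y ∈ GammaStar p) (m : ℕ) :
    (odo p)^[p * m] (consDigit s y) = consDigit s ((odo p)^[m] y) := by
  induction m with
  | zero => rfl
  | succ m ih =>
    rw [mul_add, mul_one, add_comm, Function.iterate_add_apply, ih,
      odo_iterate_period hs (odo_iterate_mem hy m), Function.iterate_succ_apply']

lemma phiSum_mul {p s : ℕ} (hs : s < p) {y : ℕ → ℕ} (hy : y ∈ GammaStar p) (m : ℕ) :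
    phiSum p (p * m) (consDigit s y) =
      m * ∑ j ∈ Finset.range (p - 1), j + phiSum p m y := by
  induction m with
  | zero => simp [phiSum_zero]
  | succ m ih =>
    rw [mul_add, mul_one, phiSum_add, ih, odo_iterate_mul hs hy,
      phiSum_period hs (odo_iterate_mem hy m), phiSum_add, phiSum_one]
    ring

/-- The sum of the `k` largest values of the functional `φ`. -/
def topSum (p k : ℕ) : ℕ := ∑ j ∈ Finset.range k, (p - 2 - j)

lemma topSum_succ (p k : ℕ) : topSum p (k + 1) = topSum p k + (p - 2 - k) :=
  Finset.sum_range_succ _ _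

lemma sum_top_eq_topSum {p k : ℕ} (hk : k ≤ p - 1) :
    ∑ j ∈ Finset.range k, (p - 1 - k + j) = topSum p k := by
  rw [topSum, ← Finset.sum_range_reflect]
  refine Finset.sum_congr rfl fun j hj => ?_
  have := Finset.mem_range.mp hj
  omega

lemma sum_le_topSum {p s k : ℕ} (h : s + k ≤ p - 1) :
    ∑ j ∈ Finset.range k, (s + j) ≤ topSum p k := by
  rw [← sum_top_eq_topSum (by omega)]
  exact Finset.sum_le_sum fun j _ => by omega

lemma sum_wrap_le_topSum {p s i : ℕ} (hs : s < p) (hi : i < p) (h : p ≤ s + i) :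
    ∑ j ∈ Finset.range (p - 1 - s), (s + j) + ∑ j ∈ Finset.range (s + i - p), j ≤
      topSum p (i - 1) := by
  rw [← sum_top_eq_topSum (by omega),
    show i - 1 = (s + i - p) + (p - 1 - s) by omega, Finset.sum_range_add, add_comm]
  exact add_le_add (Finset.sum_le_sum fun j _ => by omega) (Finset.sum_le_sum fun j _ => by omega)

/-- The set of values of `φ^(m)` on `Γ*`. -/
def phiSumRange (p m : ℕ) : Set ℕ := phiSum p m '' GammaStar p

lemma zero_mem_GammaStar {p : ℕ} (hp : 2 ≤ p) : (fun _ => 0) ∈ GammaStar p := by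
  refine ⟨fun _ => show 0 < p by omega, ?_⟩
  have h : (0 : ℕ) ≠ p - 1 := by omega
  simpa [h] using Set.infinite_univ

lemma phiSumRange_isGreatest_sSup {p : ℕ} (hp : 2 ≤ p) (m : ℕ) :
    IsGreatest (phiSumRange p m) (sSup (phiSumRange p m)) := by
  have hne : (phiSumRange p m).Nonempty := ⟨_, _, zero_mem_GammaStar hp, rfl⟩
  have hb : BddAbove (phiSumRange p m) :=
    ⟨m * (p - 2), by rintro _ ⟨x, hx, rfl⟩; exact phiSum_le hx⟩
  exact ⟨Nat.sSup_mem hne hb, fun _ h => le_csSup hb h⟩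

lemma phiSumRange_isGreatest_zero {p : ℕ} (hp : 2 ≤ p) : IsGreatest (phiSumRange p 0) 0 :=
  ⟨⟨_, zero_mem_GammaStar hp, rfl⟩, by rintro _ ⟨x, hx, rfl⟩; rfl⟩

lemma phiSumRange_isGreatest_one {p : ℕ} (hp : 2 ≤ p) :
    IsGreatest (phiSumRange p 1) (p - 2) := by
  refine ⟨⟨consDigit (p - 2) (fun _ => 0),
    consDigit_mem_iff.mpr ⟨by omega, zero_mem_GammaStar hp⟩, ?_⟩, ?_⟩
  · rw [phiSum_one, phi_consDigit_of_ne (by omega)]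
  · rintro _ ⟨x, hx, rfl⟩
    rw [phiSum_one]; exact phi_le hx

lemma phiSumRange_isGreatest_mul {p m a : ℕ} (hp : 2 ≤ p) (ha : IsGreatest (phiSumRange p m) a) :
    IsGreatest (phiSumRange p (p * m)) (m * ∑ j ∈ Finset.range (p - 1), j + a) := by
  constructor
  · obtain ⟨y, hy, rfl⟩ := ha.1
    exact ⟨consDigit 0 y, consDigit_mem_iff.mpr ⟨by omega, hy⟩, phiSum_mul (by omega) hy m⟩
  · rintro _ ⟨x, hx, rfl⟩
    rw [← consDigit_eta x] at hx ⊢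
    obtain ⟨hs, hy⟩ := consDigit_mem_iff.mp hx
    rw [phiSum_mul hs hy]
    gcongr
    exact ha.2 ⟨_, hy, rfl⟩

lemma phiSumRange_isGreatest_mul_add {p m i a b : ℕ} (hi0 : 1 ≤ i) (hi : i < p)
    (ha : IsGreatest (phiSumRange p m) a) (hb : IsGreatest (phiSumRange p (m + 1)) b) :
    IsGreatest (phiSumRange p (p * m + i))
      (m * ∑ j ∈ Finset.range (p - 1), j + max (a + topSum p i) (b + topSum p (i - 1))) := by
  have key : ∀ {s : ℕ} {y : ℕ → ℕ}, s < p → y ∈ GammaStar p →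
      phiSum p (p * m + i) (consDigit s y) = m * ∑ j ∈ Finset.range (p - 1), j +
        if s + i ≤ p - 1 then phiSum p m y + ∑ j ∈ Finset.range i, (s + j)
        else phiSum p (m + 1) y + (∑ j ∈ Finset.range (p - 1 - s), (s + j) +
          ∑ j ∈ Finset.range (s + i - p), j) := by
    intro s y hs hy
    rw [phiSum_add, phiSum_mul hs hy, odo_iterate_mul hs hy]
    split_ifs with h
    · rw [phiSum_consDigit_of_le h]; ring
    · rw [phiSum_consDigit_of_ge hs hi (by omega) (odo_iterate_mem hy m), phiSum_add p m 1,
        phiSum_one]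
      ring
  constructor
  · rcases le_total (b + topSum p (i - 1)) (a + topSum p i) with h | h
    · rw [max_eq_left h]
      obtain ⟨y, hy, rfl⟩ := ha.1
      refine ⟨consDigit (p - 1 - i) y, consDigit_mem_iff.mpr ⟨by omega, hy⟩, ?_⟩
      rw [key (by omega) hy, if_pos (by omega), sum_top_eq_topSum (by omega)]
    · rw [max_eq_right h]
      obtain ⟨y, hy, rfl⟩ := hb.1
      refine ⟨consDigit (p - i) y, consDigit_mem_iff.mpr ⟨by omega, hy⟩, ?_⟩
      rw [key (by omega) hy, if_neg (by omega), ← sum_top_eq_topSum (by omega),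
        show p - i + i - p = 0 by omega, show p - 1 - (p - i) = i - 1 by omega,
        show p - 1 - (i - 1) = p - i by omega]
      simp
  · rintro _ ⟨x, hx, rfl⟩
    rw [← consDigit_eta x] at hx ⊢
    obtain ⟨hs, hy⟩ := consDigit_mem_iff.mp hx
    rw [key hs hy]
    gcongr
    split_ifs with h
    · exact le_max_of_le_left (add_le_add (ha.2 ⟨_, hy, rfl⟩) (sum_le_topSum h))
    · exact le_max_of_le_right
        (add_le_add (hb.2 ⟨_, hy, rfl⟩) (sum_wrap_le_topSum hs hi (by omega)))

lemma measurable_digitsOf (p : ℕ) : Measurable (digitsOf p) := by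
  refine measurable_pi_lambda _ fun i => ?_
  have h : Measurable fun u : ℝ => ⌊u * (p : ℝ) ^ (i + 1)⌋ :=
    Int.measurable_floor.comp (measurable_id.mul_const _)
  exact (measurable_of_countable fun z : ℤ => z.toNat % p).comp h

lemma digitsOf_zero_add_div {p c : ℕ} (hp : 0 < p) (hc : c < p) {v : ℝ} (hv : v ∈ Set.Ico (0 : ℝ) 1) :
    digitsOf p ((c + v) / p) 0 = c := by
  have hp' : (p : ℝ) ≠ 0 := by positivity
  have h : ⌊((c + v) / p : ℝ) * (p : ℝ) ^ (0 + 1)⌋ = c := by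
    rw [zero_add, pow_one, div_mul_cancel₀ _ hp', Int.floor_eq_iff]
    constructor <;> push_cast <;> linarith [hv.1, hv.2]
  rw [digitsOf, h, Int.toNat_natCast, Nat.mod_eq_of_lt hc]

lemma digitsOf_succ_add_div {p c : ℕ} (hp : 0 < p) {v : ℝ} (hv : 0 ≤ v) (i : ℕ) :
    digitsOf p ((c + v) / p) (i + 1) = digitsOf p v i := by
  have hp' : (p : ℝ) ≠ 0 := by positivity
  have h : ((c + v) / p : ℝ) * (p : ℝ) ^ (i + 1 + 1) =
      v * (p : ℝ) ^ (i + 1) + ((c * p ^ (i + 1) : ℕ) : ℝ) := by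
    push_cast
    field_simp
    ring
  have h0 : 0 ≤ ⌊v * (p : ℝ) ^ (i + 1)⌋ := Int.floor_nonneg.mpr (by positivity)
  rw [digitsOf, digitsOf, h, Int.floor_add_natCast, Int.toNat_add_nat h0,
    pow_succ p i, ← mul_assoc, Nat.add_mul_mod_self_right]

lemma exists_Ico_digitsOf_eq {p : ℕ} (hp : 0 < p) (N : ℕ) {x : ℕ → ℕ} (hx : ∀ i, x i < p) :
    ∃ a b : ℝ, 0 ≤ a ∧ a < b ∧ b ≤ 1 ∧
      ∀ u ∈ Set.Ico a b, ∀ i < N, digitsOf p u i = x i := by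
  induction N generalizing x with
  | zero => exact ⟨0, 1, le_rfl, one_pos, le_rfl, by simp⟩
  | succ N ih =>
    obtain ⟨a, b, ha, hab, hb, h⟩ := ih (x := fun i => x (i + 1)) fun i => hx (i + 1)
    have hp' : (0 : ℝ) < p := by positivity
    have hx0 : (x 0 : ℝ) + 1 ≤ p := by exact_mod_cast hx 0
    refine ⟨(x 0 + a) / p, (x 0 + b) / p, by positivity, by gcongr, ?_, ?_⟩
    · rw [div_le_one hp']; linarith
    · rintro u ⟨hu1, hu2⟩ i hi
      rw [div_le_iff₀ hp'] at hu1
      rw [lt_div_iff₀ hp'] at hu2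
      obtain ⟨v, rfl⟩ : ∃ v, u = (x 0 + v) / p := ⟨u * p - x 0, by field_simp; ring⟩
      rw [div_mul_cancel₀ _ hp'.ne'] at hu1 hu2
      have hav : a ≤ v := by linarith
      have hvb : v < b := by linarith
      cases i with
      | zero => exact digitsOf_zero_add_div hp (hx 0) ⟨by linarith, by linarith⟩
      | succ i =>
        rw [digitsOf_succ_add_div hp (by linarith)]
        exact h v ⟨hav, hvb⟩ i (by omega)

lemma one_sub_fract_succ_of_digitsOf_eq {p : ℕ} (hp : 0 < p) {u : ℝ} (hu : 0 ≤ u) {k : ℕ}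
    (h : digitsOf p u k = p - 1) :
    1 - Int.fract (u * (p : ℝ) ^ (k + 1)) = p * (1 - Int.fract (u * (p : ℝ) ^ k)) := by
  have hp' : (0 : ℝ) < p := by positivity
  set f := Int.fract (u * (p : ℝ) ^ k) with hf
  have hf0 : 0 ≤ f := Int.fract_nonneg _
  have hf1 : f < 1 := Int.fract_lt_one _
  obtain ⟨n, hn⟩ : ∃ n : ℕ, ⌊u * (p : ℝ) ^ k⌋ = n :=
    Int.eq_ofNat_of_zero_le (Int.floor_nonneg.mpr (by positivity))
  have hsplit : u * (p : ℝ) ^ (k + 1) = f * p + ((n * p : ℕ) : ℝ) := by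
    have := Int.fract_add_floor (u * (p : ℝ) ^ k)
    rw [hn, ← hf] at this
    push_cast at this ⊢
    rw [pow_succ, ← mul_assoc, ← this]
    ring
  obtain ⟨c, hc⟩ : ∃ c : ℕ, ⌊f * p⌋ = c :=
    Int.eq_ofNat_of_zero_le (Int.floor_nonneg.mpr (by positivity))
  have hcp : c < p := by
    have : ⌊f * p⌋ < (p : ℤ) := by
      rw [Int.floor_lt]
      push_cast
      nlinarith
    omega
  have hcd : c = p - 1 := by
    rw [digitsOf, hsplit, Int.floor_add_natCast, hc, ← Nat.cast_add, Int.toNat_natCast,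
      Nat.add_mul_mod_self_right, Nat.mod_eq_of_lt hcp] at h
    exact h
  have hfr : Int.fract (f * p) = f * p - c := by
    rw [Int.fract, hc]
    push_cast
    rfl
  rw [hsplit, Int.fract_add_natCast, hfr, hcd, Nat.cast_sub (by omega)]
  push_cast
  ring

lemma digitsOf_mem_GammaStar {p : ℕ} (hp : 2 ≤ p) {u : ℝ} (hu : 0 ≤ u) :
    digitsOf p u ∈ GammaStar p := by
  refine ⟨fun i => Nat.mod_lt _ (by omega), ?_⟩
  rw [← Nat.frequently_atTop_iff_infinite]
  intro hev
  obtain ⟨N, hN⟩ := Filter.eventually_atTop.mp hev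
  simp only [ne_eq, not_not] at hN
  have hk : ∀ k, 1 - Int.fract (u * (p : ℝ) ^ (N + k)) =
      (p : ℝ) ^ k * (1 - Int.fract (u * (p : ℝ) ^ N)) := by
    intro k
    induction k with
    | zero => simp
    | succ k ih =>
      rw [← add_assoc, one_sub_fract_succ_of_digitsOf_eq (by omega) hu (hN _ (by omega)), ih]
      ring
  have hpos : 0 < 1 - Int.fract (u * (p : ℝ) ^ N) := sub_pos.mpr (Int.fract_lt_one _)
  obtain ⟨k, hk'⟩ := pow_unbounded_of_one_lt (1 - Int.fract (u * (p : ℝ) ^ N))⁻¹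
    (show (1 : ℝ) < p by exact_mod_cast (by omega : 1 < p))
  rw [inv_lt_iff_one_lt_mul₀ hpos, ← hk k] at hk'
  linarith [Int.fract_nonneg (u * (p : ℝ) ^ (N + k))]

lemma measurableSet_GammaStar (p : ℕ) : MeasurableSet (GammaStar p) := by
  have h : GammaStar p = (⋂ i, {x : ℕ → ℕ | x i < p}) ∩
      ⋂ n : ℕ, ⋃ i : ℕ, ⋃ _ : n ≤ i, {x : ℕ → ℕ | x i ≠ p - 1} := by
    ext x
    simp [GammaStar, ← Nat.frequently_atTop_iff_infinite, Filter.frequently_atTop]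
  rw [h]
  have hm : ∀ (i : ℕ) (s : Set ℕ), MeasurableSet {x : ℕ → ℕ | x i ∈ s} := fun i s =>
    measurable_pi_apply i (MeasurableSet.of_discrete (s := s))
  exact (MeasurableSet.iInter fun i => hm i {n | n < p}).inter
    (MeasurableSet.iInter fun n => MeasurableSet.iUnion fun i => MeasurableSet.iUnion fun _ =>
      hm i {n | n ≠ p - 1})

lemma lam_compl_GammaStar {p : ℕ} (hp : 2 ≤ p) : lam p (GammaStar p)ᶜ = 0 := by
  have hm := (measurableSet_GammaStar p).compl
  rw [lam, Measure.map_apply (measurable_digitsOf p) hm,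
    Measure.restrict_apply (measurable_digitsOf p hm)]
  convert measure_empty (μ := (volume : Measure ℝ))
  rw [← Set.disjoint_iff_inter_eq_empty, Set.disjoint_left]
  exact fun u hu hu' => hu (digitsOf_mem_GammaStar hp hu'.1)

lemma lam_cylinder_ne_zero {p : ℕ} (hp : 0 < p) (N : ℕ) {x : ℕ → ℕ} (hx : ∀ i, x i < p) :
    lam p {y | ∀ i < N, y i = x i} ≠ 0 := by
  have hm : MeasurableSet {y : ℕ → ℕ | ∀ i < N, y i = x i} := by
    simp only [Set.ofPred_forall]
    exact MeasurableSet.iInter fun i => MeasurableSet.iInter fun _ =>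
      measurableSet_eq_fun (measurable_pi_apply i) measurable_const
  obtain ⟨a, b, ha, hab, hb, h⟩ := exists_Ico_digitsOf_eq hp N hx
  rw [lam, Measure.map_apply (measurable_digitsOf p) hm,
    Measure.restrict_apply (measurable_digitsOf p hm)]
  have hpos : 0 < volume (Set.Ico a b) := by simpa using hab
  refine (hpos.trans_le (measure_mono fun u hu => ?_)).ne'
  exact ⟨h u hu, ha.trans hu.1, hu.2.trans_le hb⟩

lemma pim_ne_zero_iff {p : ℕ} (hp : 2 ≤ p) (m j : ℕ) :
    pim p m j ≠ 0 ↔ j ∈ phiSumRange p m := by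
  constructor
  · intro h
    by_contra hj
    refine h (measure_mono_null (fun x hx hxG => hj ⟨x, hxG, hx⟩) (lam_compl_GammaStar hp))
  · rintro ⟨x, hx, rfl⟩ h
    obtain ⟨N, hN⟩ := exists_phiSum_eq_of_digits_eq m hx
    exact lam_cylinder_ne_zero (by omega) N hx.1 (measure_mono_null (fun y hy => hN y hy) h)

lemma D_isGreatest {p : ℕ} (hp : 2 ≤ p) (m : ℕ) : IsGreatest (phiSumRange p m) (D p m) := by
  have h : {j | pim p m j ≠ 0} = phiSumRange p m := Set.ext fun j => pim_ne_zero_iff hp m j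
  rw [D, h]
  exact phiSumRange_isGreatest_sSup hp m

lemma D_zero {p : ℕ} (hp : 2 ≤ p) : D p 0 = 0 :=
  (D_isGreatest hp 0).unique (phiSumRange_isGreatest_zero hp)

lemma D_one {p : ℕ} (hp : 2 ≤ p) : D p 1 = p - 2 :=
  (D_isGreatest hp 1).unique (phiSumRange_isGreatest_one hp)

lemma D_mul {p : ℕ} (hp : 2 ≤ p) (m : ℕ) :
    D p (p * m) = m * ∑ j ∈ Finset.range (p - 1), j + D p m :=
  (D_isGreatest hp _).unique (phiSumRange_isGreatest_mul hp (D_isGreatest hp m))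

lemma D_mul_add {p i : ℕ} (hp : 2 ≤ p) (m : ℕ) (hi0 : 1 ≤ i) (hi : i < p) :
    D p (p * m + i) = m * ∑ j ∈ Finset.range (p - 1), j +
      max (D p m + topSum p i) (D p (m + 1) + topSum p (i - 1)) :=
  (D_isGreatest hp _).unique
    (phiSumRange_isGreatest_mul_add hi0 hi (D_isGreatest hp m) (D_isGreatest hp (m + 1)))

lemma sum_range_eq_topSum (p : ℕ) : ∑ j ∈ Finset.range (p - 1), j = topSum p (p - 1) := by
  simpa using sum_top_eq_topSum (le_refl (p - 1))

lemma D_succ_of_lt {p k : ℕ} (hp : 2 ≤ p) (hk : k < p) :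
    D p (k + 1) = p - 2 + topSum p k := by
  rcases Nat.lt_or_ge (k + 1) p with h | h
  · have := D_mul_add hp 0 (Nat.le_add_left 1 k) h
    rw [mul_zero, zero_add, zero_mul, zero_add, D_zero hp, zero_add, zero_add, D_one hp,
      Nat.add_sub_cancel, topSum_succ] at this
    omega
  · have := D_mul hp 1
    rw [mul_one, one_mul, D_one hp, sum_range_eq_topSum] at this
    rw [show k + 1 = p by omega, this, show k = p - 1 by omega, add_comm]

lemma D_succ_eq_add {p m : ℕ} (hp : 2 ≤ p) (hm : m < p) :
    D p (m + 1) = D p m + if m = 0 then p - 2 else p - 1 - m := by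
  cases m with
  | zero => simp [D_zero hp, D_one hp]
  | succ k =>
    rw [D_succ_of_lt hp hm, D_succ_of_lt hp (by omega), topSum_succ, if_neg (by omega)]
    omega

/-- the first `p²` values of `S_j = D_{j+1} - D_j` coincide with the
first-tier substitution sequence: for `0 ≤ m ≤ p-1` and `0 ≤ i ≤ p-1`,
`S_{pm+i} = B(A_m)_i`, where `A_0 = p-2`, `A_m = p-1-m` for `1 ≤ m ≤ p-1`. -/
theorem statement_11 (p : ℕ) (hp : 3 ≤ p) (m i : ℕ) (hm : m ≤ p - 1) (hi : i ≤ p - 1) :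
    Sseq p (p * m + i) = blockB p (if m = 0 then p - 2 else p - 1 - m) i := by
  have hp2 : 2 ≤ p := by omega
  have hD := D_succ_eq_add hp2 (show m < p by omega)
  have hA : (if m = 0 then p - 2 else p - 1 - m) ≤ p - 2 := by split_ifs <;> omega
  generalize (if m = 0 then p - 2 else p - 1 - m) = q at hD hA ⊢
  have hnext : D p (p * m + i + 1) = m * ∑ j ∈ Finset.range (p - 1), j +
      max (D p m + topSum p (i + 1)) (D p (m + 1) + topSum p i) := by
    rcases Nat.lt_or_ge (i + 1) p with h | h
    · rw [add_assoc (p * m), D_mul_add hp2 m (Nat.le_add_left 1 i) h, Nat.add_sub_cancel]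
    · obtain rfl : i = p - 1 := by omega
      rw [show p * m + (p - 1) + 1 = p * (m + 1) by rw [mul_add, mul_one]; omega, D_mul hp2,
        topSum_succ, add_mul, one_mul, add_assoc, hD, sum_range_eq_topSum,
        show p - 2 - (p - 1) = 0 by omega, add_zero, max_eq_right (by omega)]
      ring
  unfold Sseq blockB
  rw [hnext, hD, topSum_succ]
  cases i with
  | zero =>
    rw [add_zero, D_mul hp2]
    simp only [topSum, Finset.range_zero, Finset.sum_empty]
    split_ifs <;> omega
  | succ k =>
    rw [D_mul_add hp2 m (Nat.le_add_left 1 k) (by omega), hD, Nat.add_sub_cancel, topSum_succ]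
    split_ifs <;> omega

end Chacon
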